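/- For every η > 0 there exists a constant C > 0 such that for all T ≥ 2, the number of matrices γ ∈ Γ_T with |Tr(γ)| ≤ 2 is at most C·T^{1+η}. Consequently ℙ_T(|Tr(γ)| > 2) = 1 − O(T^{−1+η}). -/

import Mathlib

noncomputable section

open Matrix Filter Topology

/-- `Γ = SL(2,ℤ)`. -/
abbrev SL2Z := Matrix.SpecialLinearGroup (Fin 2) ℤ

/-- Frobenius norm of a matrix in `SL(2,ℤ)`. -/
noncomputable def frobNorm (γ : SL2Z) : ℝ :=
  Real.sqrt ((γ 0 0 ^ 2 + γ 0 1 ^ 2 + γ 1 0 ^ 2 + γ 1 1 ^ 2 : ℤ) : ℝ)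

/-- Trace of a matrix in `SL(2,ℤ)`. -/
def trZ (γ : SL2Z) : ℤ := γ 0 0 + γ 1 1

/-- The divisor bound `d(n) = O(n ^ ε)`. -/
theorem exists_card_divisors_le_rpow {ε : ℝ} (hε : 0 < ε) :
    ∃ C : ℝ, 0 < C ∧ ∀ n : ℕ, (n.divisors.card : ℝ) ≤ C * (n : ℝ) ^ ε := by
  obtain ⟨M, hM⟩ := exists_nat_ge ((2 : ℝ) ^ (1 / ε))
  set L : ℝ := ε * Real.log 2 with hL
  have hLpos : 0 < L := mul_pos hε (Real.log_pos one_lt_two)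
  set K : ℝ := 1 + 1 / L with hK
  have hK1 : 1 ≤ K := by rw [hK]; have := one_div_pos.2 hLpos; linarith
  have small (p k : ℕ) (hp : 2 ≤ p) : (k : ℝ) + 1 ≤ K * ((p : ℝ) ^ k) ^ ε := by
    have h1 : (k : ℝ) * L + 1 ≤ ((p : ℝ) ^ k) ^ ε := calc
      (k : ℝ) * L + 1 ≤ Real.exp (k * L) := Real.add_one_le_exp _
      _ = ((2 : ℝ) ^ k) ^ ε := by
        rw [Real.rpow_def_of_pos (by positivity), Real.log_pow, hL]; ring_nf
      _ ≤ _ := by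
        have : (2 : ℝ) ≤ p := by exact_mod_cast hp
        gcongr
    have h2 : K * ((k : ℝ) * L + 1) = k + 1 + (k * L + 1 / L) := by
      rw [hK]; field_simp; ring
    have h3 : 0 ≤ (k : ℝ) * L + 1 / L := by positivity
    have := mul_le_mul_of_nonneg_left h1 (by linarith : 0 ≤ K)
    linarith
  have large (p k : ℕ) (hp : M ≤ p) : (k : ℝ) + 1 ≤ ((p : ℝ) ^ k) ^ ε := by
    have h2 : (2 : ℝ) ≤ (p : ℝ) ^ ε := calc
      (2 : ℝ) = ((2 : ℝ) ^ (1 / ε)) ^ ε := by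
        rw [← Real.rpow_mul (by norm_num), one_div_mul_cancel hε.ne', Real.rpow_one]
      _ ≤ _ := by
        have : (M : ℝ) ≤ p := by exact_mod_cast hp
        exact Real.rpow_le_rpow (by positivity) (hM.trans this) hε.le
    calc (k : ℝ) + 1 ≤ 2 ^ k := by exact_mod_cast Nat.lt_two_pow_self
      _ ≤ ((p : ℝ) ^ ε) ^ k := by gcongr
      _ = _ := by
        rw [← Real.rpow_natCast, ← Real.rpow_mul (by positivity), mul_comm,
          Real.rpow_mul (by positivity), Real.rpow_natCast]
  refine ⟨K ^ M, by positivity, fun n ↦ ?_⟩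
  rcases eq_or_ne n 0 with rfl | hn
  · simp [Real.zero_rpow hε.ne']
  have hprod : ((n : ℕ) : ℝ) ^ ε = ∏ p ∈ n.primeFactors, ((p : ℝ) ^ n.factorization p) ^ ε := by
    rw [Real.finsetProd_rpow _ _ fun _ _ ↦ by positivity]
    conv_lhs => rw [← Nat.prod_factorization_pow_eq_self hn]
    rw [Finsupp.prod, Nat.support_factorization]
    push_cast
    rfl
  rw [Nat.card_divisors hn, hprod]
  push_cast
  calc ∏ p ∈ n.primeFactors, ((n.factorization p : ℝ) + 1)
      ≤ ∏ p ∈ n.primeFactors,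
          ((if p < M then K else 1) * ((p : ℝ) ^ n.factorization p) ^ ε) := by
        refine Finset.prod_le_prod (fun _ _ ↦ by positivity) fun p hp ↦ ?_
        split_ifs with h
        · exact small p _ (Nat.prime_of_mem_primeFactors hp).two_le
        · rw [one_mul]; exact large p _ (not_lt.1 h)
    _ = K ^ (n.primeFactors.filter (· < M)).card *
          ∏ p ∈ n.primeFactors, ((p : ℝ) ^ n.factorization p) ^ ε := by
        rw [Finset.prod_mul_distrib, Finset.prod_ite]; simp
    _ ≤ _ := by
        have hcard : (n.primeFactors.filter (· < M)).card ≤ M := calc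
          _ ≤ (Finset.range M).card := Finset.card_le_card fun p hp ↦ by
            simpa using (Finset.mem_filter.1 hp).2
          _ = M := Finset.card_range M
        gcongr

theorem sum_Icc_two_one_div_sq_le (N : ℕ) :
    ∑ g ∈ Finset.Icc 2 N, (1 / (g : ℝ) ^ 2) ≤ 3 / 4 := by
  rcases lt_or_ge N 2 with h | h
  · rw [Finset.Icc_eq_empty (by omega)]; norm_num
  suffices ∑ g ∈ Finset.Icc 2 N, (1 / (g : ℝ) ^ 2) ≤ 3 / 4 - 1 / (N : ℝ) by
    have : 0 ≤ 1 / (N : ℝ) := by positivity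
    linarith
  induction N, h using Nat.le_induction with
  | base => norm_num
  | succ n hn ih =>
    rw [Finset.sum_Icc_succ_top (by omega)]
    have hn0 : (0 : ℝ) < n := by exact_mod_cast (by omega : 0 < n)
    have : 1 / ((n : ℝ) + 1) ^ 2 ≤ 1 / n - 1 / (n + 1) := by
      rw [div_sub_div _ _ hn0.ne' (by positivity), div_le_div_iff₀ (by positivity) (by positivity)]
      nlinarith
    push_cast
    linarith

/-- A positive proportion of the pairs in `[1, N]²` are coprime. -/
theorem sq_div_four_le_card_coprime (N : ℕ) :
    (N : ℝ) ^ 2 / 4 ≤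
      (((Finset.Icc 1 N ×ˢ Finset.Icc 1 N).filter fun p ↦ p.1.Coprime p.2).card : ℝ) := by
  set B := Finset.Icc 1 N ×ˢ Finset.Icc 1 N with hB
  have hsub : (B.filter fun p ↦ ¬ p.1.Coprime p.2) ⊆
      (Finset.Icc 2 N).biUnion fun g ↦
        (Finset.Icc 1 (N / g) ×ˢ Finset.Icc 1 (N / g)).image fun q ↦ (g * q.1, g * q.2) := by
    rintro ⟨x, y⟩ h
    simp only [hB, Finset.mem_filter, Finset.mem_product, Finset.mem_Icc] at h
    obtain ⟨⟨⟨hx1, hxN⟩, hy1, hyN⟩, hxy⟩ := h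
    have hg : 0 < x.gcd y := Nat.gcd_pos_of_pos_left _ hx1
    have hgx : x.gcd y ≤ x := Nat.gcd_le_left _ hx1
    have hgy : x.gcd y ≤ y := Nat.gcd_le_right _ hy1
    simp only [Finset.mem_biUnion, Finset.mem_image, Finset.mem_product, Finset.mem_Icc,
      Prod.exists, Prod.mk.injEq]
    refine ⟨x.gcd y, ⟨?_, by omega⟩, x / x.gcd y, y / x.gcd y, ⟨⟨?_, ?_⟩, ?_, ?_⟩, ?_, ?_⟩
    · rw [Nat.Coprime] at hxy; omega
    · exact Nat.div_pos hgx hg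
    · exact Nat.div_le_div_right hxN
    · exact Nat.div_pos hgy hg
    · exact Nat.div_le_div_right hyN
    · exact Nat.mul_div_cancel' (Nat.gcd_dvd_left _ _)
    · exact Nat.mul_div_cancel' (Nat.gcd_dvd_right _ _)
  have hcard : ((B.filter fun p ↦ ¬ p.1.Coprime p.2).card : ℝ) ≤ 3 / 4 * (N : ℝ) ^ 2 := calc
    _ ≤ ((∑ g ∈ Finset.Icc 2 N, (N / g) * (N / g) : ℕ) : ℝ) := by
      refine Nat.cast_le.2 ((Finset.card_le_card hsub).trans (Finset.card_biUnion_le.trans ?_))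
      refine Finset.sum_le_sum fun g _ ↦ Finset.card_image_le.trans ?_
      simp
    _ ≤ ∑ g ∈ Finset.Icc 2 N, (1 / (g : ℝ) ^ 2) * (N : ℝ) ^ 2 := by
      push_cast
      refine Finset.sum_le_sum fun g _ ↦ ?_
      calc ((N / g : ℕ) : ℝ) * ((N / g : ℕ) : ℝ) ≤ ((N : ℝ) / g) * ((N : ℝ) / g) := by
            gcongr <;> exact Nat.cast_div_le
        _ = _ := by ring
    _ ≤ _ := by
      rw [← Finset.sum_mul]
      gcongr
      exact sum_Icc_two_one_div_sq_le N
  have hadd := Finset.card_filter_add_card_filter_not (s := B) fun p ↦ p.1.Coprime p.2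
  have htot : B.card = N * N := by simp [hB]
  rw [htot] at hadd
  have : ((B.filter fun p ↦ p.1.Coprime p.2).card : ℝ) +
      ((B.filter fun p ↦ ¬ p.1.Coprime p.2).card : ℝ) = N * N := by exact_mod_cast hadd
  nlinarith

theorem frobNorm_le_iff {γ : SL2Z} {T : ℝ} (hT : 0 ≤ T) :
    frobNorm γ ≤ T ↔
      (γ 0 0 : ℝ) ^ 2 + (γ 0 1 : ℝ) ^ 2 + (γ 1 0 : ℝ) ^ 2 + (γ 1 1 : ℝ) ^ 2 ≤ T ^ 2 := by
  rw [frobNorm, Real.sqrt_le_left hT]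
  push_cast
  rfl

theorem det_entries (γ : SL2Z) : γ 0 0 * γ 1 1 - γ 0 1 * γ 1 0 = 1 := by
  rw [← Matrix.det_fin_two]
  exact γ.det_coe

theorem SL2Z_ext {γ δ : SL2Z} (h00 : γ 0 0 = δ 0 0) (h01 : γ 0 1 = δ 0 1)
    (h10 : γ 1 0 = δ 1 0) (h11 : γ 1 1 = δ 1 1) : γ = δ := by
  ext i j
  fin_cases i <;> fin_cases j <;> assumption

theorem entry_mem_Icc_of_frobNorm_le {γ : SL2Z} {T : ℝ} (hT : 0 ≤ T) (h : frobNorm γ ≤ T)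
    (i j : Fin 2) : γ i j ∈ Finset.Icc (-(⌊T⌋₊ : ℤ)) ⌊T⌋₊ := by
  rw [frobNorm_le_iff hT] at h
  have hsq : (γ i j : ℝ) ^ 2 ≤ T ^ 2 := by
    fin_cases i <;> fin_cases j <;> simp only [Fin.zero_eta, Fin.mk_one] <;>
      nlinarith [sq_nonneg (γ 0 0 : ℝ), sq_nonneg (γ 0 1 : ℝ), sq_nonneg (γ 1 0 : ℝ),
        sq_nonneg (γ 1 1 : ℝ)]
  have habs : ((γ i j).natAbs : ℝ) ≤ T := by
    rw [Nat.cast_natAbs, Int.cast_abs]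
    exact abs_le_of_sq_le_sq hsq hT
  have := Nat.le_floor habs
  rw [Finset.mem_Icc]
  omega

theorem finite_frobNorm_le {T : ℝ} (hT : 0 ≤ T) : Finite {γ : SL2Z // frobNorm γ ≤ T} := by
  let I := Finset.Icc (-(⌊T⌋₊ : ℤ)) ⌊T⌋₊
  refine Finite.of_injective (β := Fin 2 → Fin 2 → I)
    (fun γ i j ↦ ⟨γ.1 i j, entry_mem_Icc_of_frobNorm_le hT γ.2 i j⟩) fun γ δ h ↦ ?_
  ext i j
  exact congrArg Subtype.val (congrFun (congrFun h i) j)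

/-- The integer points of height at most `M` on the curve `x y = n`. -/
def hyperbolaPoints (M : ℕ) (n : ℤ) : Finset (ℤ × ℤ) :=
  (Finset.Icc (-(M : ℤ)) M ×ˢ Finset.Icc (-(M : ℤ)) M).filter fun p ↦ p.1 * p.2 = n

theorem card_hyperbolaPoints_le_divisors (M : ℕ) {n : ℤ} (hn : n ≠ 0) :
    (hyperbolaPoints M n).card ≤ 2 * n.natAbs.divisors.card := by
  let D := n.natAbs.divisors
  have hmaps : ∀ p ∈ hyperbolaPoints M n,
      p.1 ∈ D.image (fun d : ℕ ↦ (d : ℤ)) ∪ D.image (fun d : ℕ ↦ -(d : ℤ)) := by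
    intro p hp
    have hmul := (Finset.mem_filter.1 hp).2
    have hD : p.1.natAbs ∈ D :=
      Nat.mem_divisors.2 ⟨Int.natAbs_dvd_natAbs.2 ⟨p.2, hmul.symm⟩, Int.natAbs_ne_zero.2 hn⟩
    rcases Int.natAbs_eq p.1 with h | h
    · exact Finset.mem_union_left _ (Finset.mem_image.2 ⟨_, hD, h.symm⟩)
    · exact Finset.mem_union_right _ (Finset.mem_image.2 ⟨_, hD, h.symm⟩)
  have hinj : Set.InjOn Prod.fst (hyperbolaPoints M n : Set (ℤ × ℤ)) := by
    intro p hp q hq hpq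
    have h1 := (Finset.mem_filter.1 hp).2
    have h2 := (Finset.mem_filter.1 hq).2
    refine Prod.ext hpq (mul_left_cancel₀ (left_ne_zero_of_mul (h1.trans_ne hn)) ?_)
    rw [h1, hpq, h2]
  calc _ ≤ _ := Finset.card_le_card_of_injOn Prod.fst hmaps hinj
    _ ≤ _ := Finset.card_union_le _ _
    _ ≤ D.card + D.card := add_le_add Finset.card_image_le Finset.card_image_le
    _ = _ := (two_mul _).symm

theorem card_hyperbolaPoints_zero_le (M : ℕ) :
    (hyperbolaPoints M 0).card ≤ 2 * (2 * M + 1) := by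
  let I := Finset.Icc (-(M : ℤ)) M
  have hI : I.card = 2 * M + 1 := by simp [I]; omega
  have hsub : hyperbolaPoints M 0 ⊆ ({0} ×ˢ I) ∪ (I ×ˢ {0}) := by
    rintro ⟨x, y⟩ h
    obtain ⟨hm, hz⟩ := Finset.mem_filter.1 h
    rw [Finset.mem_product] at hm
    rcases mul_eq_zero.1 hz with h0 | h0
    · exact Finset.mem_union_left _ (Finset.mem_product.2 ⟨Finset.mem_singleton.2 h0, hm.2⟩)
    · exact Finset.mem_union_right _ (Finset.mem_product.2 ⟨hm.1, Finset.mem_singleton.2 h0⟩)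
  calc _ ≤ _ := Finset.card_le_card hsub
    _ ≤ _ := Finset.card_union_le _ _
    _ = _ := by simp only [Finset.card_product, Finset.card_singleton, hI]; ring

/-- Fibering over the trace and the upper left entry. -/
theorem card_abs_trZ_le_two_le_sum {T : ℝ} (hT : 0 ≤ T) :
    Nat.card {γ : SL2Z // frobNorm γ ≤ T ∧ |trZ γ| ≤ 2} ≤
      ∑ p ∈ Finset.Icc (-2 : ℤ) 2 ×ˢ Finset.Icc (-(⌊T⌋₊ : ℤ)) ⌊T⌋₊,
        (hyperbolaPoints ⌊T⌋₊ (p.2 * (p.1 - p.2) - 1)).card := by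
  rw [← Finset.card_sigma, ← Nat.card_eq_finsetCard]
  have hmem (γ : {γ : SL2Z // frobNorm γ ≤ T ∧ |trZ γ| ≤ 2}) :
      (⟨(trZ γ.1, γ.1 0 0), (γ.1 0 1, γ.1 1 0)⟩ : (_ : ℤ × ℤ) × (ℤ × ℤ)) ∈
        (Finset.Icc (-2 : ℤ) 2 ×ˢ Finset.Icc (-(⌊T⌋₊ : ℤ)) ⌊T⌋₊).sigma
          fun p ↦ hyperbolaPoints ⌊T⌋₊ (p.2 * (p.1 - p.2) - 1) := by
    have hI := entry_mem_Icc_of_frobNorm_le hT γ.2.1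
    refine Finset.mem_sigma.2 ⟨Finset.mem_product.2
      ⟨Finset.mem_Icc.2 (abs_le.1 γ.2.2), hI 0 0⟩, Finset.mem_filter.2
      ⟨Finset.mem_product.2 ⟨hI 0 1, hI 1 0⟩, ?_⟩⟩
    have := det_entries γ.1
    simp only [trZ]
    linarith
  refine Nat.card_le_card_of_injective (fun γ ↦ ⟨_, hmem γ⟩) fun γ δ h ↦ Subtype.ext ?_
  simp only [Subtype.mk.injEq, Sigma.mk.injEq, Prod.mk.injEq, heq_eq_eq, trZ] at h
  obtain ⟨⟨ht, h00⟩, h01, h10⟩ := h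
  exact SL2Z_ext h00 h01 h10 (by linarith)

theorem exists_card_abs_trZ_le_two_le {η : ℝ} (hη : 0 < η) :
    ∃ C : ℝ, 0 < C ∧ ∀ T : ℝ, 2 ≤ T →
      (Nat.card {γ : SL2Z // frobNorm γ ≤ T ∧ |trZ γ| ≤ 2} : ℝ) ≤ C * T ^ (1 + η) := by
  obtain ⟨C, hC, hdiv⟩ := exists_card_divisors_le_rpow (half_pos hη)
  refine ⟨15 * (2 * C * 2 ^ η) + 60, by positivity, fun T hT ↦ ?_⟩
  have hT0 : 0 ≤ T := by linarith
  set M := ⌊T⌋₊ with hM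
  have hMT : (M : ℝ) ≤ T := Nat.floor_le hT0
  set J := Finset.Icc (-2 : ℤ) 2 ×ˢ Finset.Icc (-(M : ℤ)) M with hJ
  have hJcard : (J.card : ℝ) ≤ 5 * (3 * T) := by
    have : J.card = 5 * (2 * M + 1) := by
      simp [hJ]; omega
    rw [this]
    push_cast
    linarith
  have hfiber : ∀ p ∈ J, ((hyperbolaPoints M (p.2 * (p.1 - p.2) - 1)).card : ℝ) ≤
      2 * C * 2 ^ η * T ^ η + if p.2 * (p.1 - p.2) - 1 = 0 then 2 * (3 * T) else 0 := by
    rintro ⟨t, a⟩ hp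
    simp only [hJ, Finset.mem_product, Finset.mem_Icc] at hp
    obtain ⟨⟨ht1, ht2⟩, ha1, ha2⟩ := hp
    dsimp only
    split_ifs with h
    · rw [h]
      have h1 : ((hyperbolaPoints M 0).card : ℝ) ≤ 2 * (2 * M + 1) := by
        exact_mod_cast card_hyperbolaPoints_zero_le M
      have : 0 ≤ 2 * C * 2 ^ η * T ^ η := by positivity
      linarith
    · have h1 : ((hyperbolaPoints M (a * (t - a) - 1)).card : ℝ) ≤
          2 * ((a * (t - a) - 1).natAbs.divisors.card : ℝ) := by
        exact_mod_cast card_hyperbolaPoints_le_divisors M h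
      have h2 : ((a * (t - a) - 1).natAbs : ℝ) ≤ (2 * T) ^ 2 := by
        have : |a * (t - a) - 1| ≤ ((M : ℤ) + 1) ^ 2 := by
          rw [abs_le]; constructor <;> nlinarith
        rw [Nat.cast_natAbs]
        calc ((|a * (t - a) - 1| : ℤ) : ℝ) ≤ ((M : ℝ) + 1) ^ 2 := by exact_mod_cast this
          _ ≤ _ := by gcongr; linarith
      have h3 : ((a * (t - a) - 1).natAbs : ℝ) ^ (η / 2) ≤ 2 ^ η * T ^ η := calc
        _ ≤ ((2 * T) ^ 2) ^ (η / 2) := by gcongr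
        _ = 2 ^ η * T ^ η := by
          rw [← Real.rpow_natCast, ← Real.rpow_mul (by positivity), Nat.cast_ofNat,
            mul_div_cancel₀ _ two_ne_zero, Real.mul_rpow zero_le_two hT0]
      have h4 := hdiv (a * (t - a) - 1).natAbs
      nlinarith [mul_le_mul_of_nonneg_left h3 hC.le]
  have hzero : ((J.filter fun p ↦ p.2 * (p.1 - p.2) - 1 = 0).card : ℝ) ≤ 10 := by
    have : (J.filter fun p ↦ p.2 * (p.1 - p.2) - 1 = 0).card ≤
        (Finset.Icc (-2 : ℤ) 2 ×ˢ ({1, -1} : Finset ℤ)).card := by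
      refine Finset.card_le_card fun p hp ↦ ?_
      rw [Finset.mem_filter, hJ, Finset.mem_product] at hp
      rw [Finset.mem_product]
      refine ⟨hp.1.1, ?_⟩
      simpa using Int.isUnit_iff.1 (IsUnit.of_mul_eq_one _ (sub_eq_zero.1 hp.2))
    exact_mod_cast this
  have hTη : T * T ^ η = T ^ (1 + η) := by
    rw [Real.rpow_add (by linarith), Real.rpow_one]
  have hT1 : T ≤ T ^ (1 + η) := by
    conv_lhs => rw [← Real.rpow_one T]
    exact Real.rpow_le_rpow_of_exponent_le (by linarith) (by linarith)
  calc (Nat.card {γ : SL2Z // frobNorm γ ≤ T ∧ |trZ γ| ≤ 2} : ℝ)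
      ≤ ∑ p ∈ J, ((hyperbolaPoints M (p.2 * (p.1 - p.2) - 1)).card : ℝ) := by
        exact_mod_cast card_abs_trZ_le_two_le_sum hT0
    _ ≤ _ := Finset.sum_le_sum hfiber
    _ = J.card * (2 * C * 2 ^ η * T ^ η) +
          (J.filter fun p ↦ p.2 * (p.1 - p.2) - 1 = 0).card * (2 * (3 * T)) := by
        rw [Finset.sum_add_distrib, ← Finset.sum_filter]; simp
    _ ≤ 5 * (3 * T) * (2 * C * 2 ^ η * T ^ η) + 10 * (2 * (3 * T)) := by gcongr
    _ = 15 * (2 * C * 2 ^ η) * (T * T ^ η) + 60 * T := by ring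
    _ ≤ _ := by rw [hTη]; linarith

theorem exists_SL2Z_of_coprime {a c : ℕ} (ha : 0 < a) (hc : 0 < c) (hac : a.Coprime c) :
    ∃ γ : SL2Z, γ 0 0 = a ∧ γ 1 0 = c ∧ |γ 0 1| ≤ a ∧ |γ 1 1| ≤ c := by
  obtain ⟨u, v, huv⟩ := Nat.isCoprime_iff_coprime.2 hac
  have hc' : (0 : ℤ) < c := by exact_mod_cast hc
  set d := u % c
  set b := -v - a * (u / c)
  have hdet : (a : ℤ) * d - b * c = 1 := by
    have := Int.emod_add_mul_ediv u c
    simp only [d, b]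
    linear_combination huv + a * this
  have hd0 : 0 ≤ d := Int.emod_nonneg _ hc'.ne'
  have hdc : d < c := Int.emod_lt_of_pos _ hc'
  refine ⟨⟨!![(a : ℤ), b; c, d], by rw [Matrix.det_fin_two_of, hdet]⟩, rfl, rfl, ?_, ?_⟩
  · change |b| ≤ a
    have ha' : (0 : ℤ) < a := by exact_mod_cast ha
    have hab : b ≤ a := by nlinarith
    have hba : -a ≤ b := by
      by_contra! hlt
      nlinarith
    exact abs_le.2 ⟨hba, hab⟩
  · change |d| ≤ c
    exact abs_le.2 ⟨by linarith, hdc.le⟩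

theorem sq_div_le_card_frobNorm_le {T : ℝ} (hT : 2 ≤ T) :
    T ^ 2 / 64 ≤ (Nat.card {γ : SL2Z // frobNorm γ ≤ T} : ℝ) := by
  have hT0 : 0 ≤ T := by linarith
  have := finite_frobNorm_le hT0
  set N := ⌊T / 2⌋₊ with hN
  have hNT : (N : ℝ) ≤ T / 2 := Nat.floor_le (by linarith)
  have hTN : T / 4 ≤ N := by
    have h1 : 1 ≤ N := Nat.le_floor (by push_cast; linarith)
    have h1' : (1 : ℝ) ≤ N := by exact_mod_cast h1
    have := Nat.lt_floor_add_one (T / 2)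
    linarith
  set P := (Finset.Icc 1 N ×ˢ Finset.Icc 1 N).filter fun p ↦ p.1.Coprime p.2 with hP
  have hex : ∀ p : P, ∃ γ : SL2Z, frobNorm γ ≤ T ∧ γ 0 0 = p.1.1 ∧ γ 1 0 = p.1.2 := by
    rintro ⟨⟨a, c⟩, hp⟩
    simp only [hP, Finset.mem_filter, Finset.mem_product, Finset.mem_Icc] at hp
    obtain ⟨⟨⟨ha1, haN⟩, hc1, hcN⟩, hac⟩ := hp
    obtain ⟨γ, h00, h10, h01, h11⟩ := exists_SL2Z_of_coprime ha1 hc1 hac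
    refine ⟨γ, (frobNorm_le_iff hT0).2 ?_, h00, h10⟩
    have ha : (a : ℝ) ≤ T / 2 := le_trans (by exact_mod_cast haN) hNT
    have hc : (c : ℝ) ≤ T / 2 := le_trans (by exact_mod_cast hcN) hNT
    have hb : |(γ 0 1 : ℝ)| ≤ T / 2 := le_trans (by exact_mod_cast h01) ha
    have hd : |(γ 1 1 : ℝ)| ≤ T / 2 := le_trans (by exact_mod_cast h11) hc
    rw [h00, h10, ← sq_abs (γ 0 1 : ℝ), ← sq_abs (γ 1 1 : ℝ)]
    push_cast
    calc _ ≤ (T / 2) ^ 2 + (T / 2) ^ 2 + (T / 2) ^ 2 + (T / 2) ^ 2 := by gcongr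
      _ = T ^ 2 := by ring
  choose f hf hf0 hf1 using hex
  have hle : P.card ≤ Nat.card {γ : SL2Z // frobNorm γ ≤ T} := by
    rw [← Nat.card_eq_finsetCard]
    refine Nat.card_le_card_of_injective (fun p ↦ ⟨f p, hf p⟩) fun p q h ↦ ?_
    have hpq : f p = f q := congrArg Subtype.val h
    refine Subtype.ext (Prod.ext ?_ ?_)
    · have := hf0 p
      rw [hpq, hf0 q] at this
      exact_mod_cast this.symm
    · have := hf1 p
      rw [hpq, hf1 q] at this
      exact_mod_cast this.symm
  calc T ^ 2 / 64 = (T / 4) ^ 2 / 4 := by ring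
    _ ≤ (N : ℝ) ^ 2 / 4 := by gcongr
    _ ≤ P.card := sq_div_four_le_card_coprime N
    _ ≤ _ := by exact_mod_cast hle

theorem card_hyperbolic_add_card {T : ℝ} (hT : 0 ≤ T) :
    Nat.card {γ : SL2Z // frobNorm γ ≤ T ∧ 2 < |trZ γ|} +
      Nat.card {γ : SL2Z // frobNorm γ ≤ T ∧ |trZ γ| ≤ 2} =
      Nat.card {γ : SL2Z // frobNorm γ ≤ T} := by
  have hfin : {γ : SL2Z | frobNorm γ ≤ T}.Finite := finite_frobNorm_le hT
  have hdisj : Disjoint {γ : SL2Z | frobNorm γ ≤ T ∧ 2 < |trZ γ|}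
      {γ : SL2Z | frobNorm γ ≤ T ∧ |trZ γ| ≤ 2} :=
    Set.disjoint_left.2 fun γ h h' ↦ h'.2.not_gt h.2
  have hunion : {γ : SL2Z | frobNorm γ ≤ T ∧ 2 < |trZ γ|} ∪
      {γ : SL2Z | frobNorm γ ≤ T ∧ |trZ γ| ≤ 2} = {γ : SL2Z | frobNorm γ ≤ T} := by
    ext γ
    have := lt_or_ge 2 |trZ γ|
    simp only [Set.mem_union, Set.mem_ofPred_eq]
    tauto
  have := Set.ncard_union_eq hdisj (hfin.subset fun γ h ↦ h.1) (hfin.subset fun γ h ↦ h.1)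
  rw [hunion] at this
  exact this.symm

/-- For every `η > 0` there is `C > 0` such that for all `T ≥ 2` the number of `γ ∈ Γ_T`
with `|Tr(γ)| ≤ 2` is at most `C·T^(1+η)`; consequently
`ℙ_T(|Tr(γ)| > 2) = 1 - O(T^(-1+η))`. -/
theorem statement1 (η : ℝ) (hη : 0 < η) :
    ∃ C : ℝ, 0 < C ∧ ∀ T : ℝ, 2 ≤ T →
      (Nat.card {γ : SL2Z // frobNorm γ ≤ T ∧ |trZ γ| ≤ 2} : ℝ) ≤ C * T ^ (1 + η) ∧
      |(Nat.card {γ : SL2Z // frobNorm γ ≤ T ∧ 2 < |trZ γ|} : ℝ) /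
          (Nat.card {γ : SL2Z // frobNorm γ ≤ T} : ℝ) - 1| ≤ C * T ^ (-1 + η) := by
  obtain ⟨C, hC, hbound⟩ := exists_card_abs_trZ_le_two_le hη
  refine ⟨64 * C, by positivity, fun T hT ↦ ?_⟩
  have hT0 : 0 < T := by linarith
  have hS := hbound T hT
  have hG := sq_div_le_card_frobNorm_le hT
  have hadd : (Nat.card {γ : SL2Z // frobNorm γ ≤ T ∧ 2 < |trZ γ|} : ℝ) +
      (Nat.card {γ : SL2Z // frobNorm γ ≤ T ∧ |trZ γ| ≤ 2} : ℝ) =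
      (Nat.card {γ : SL2Z // frobNorm γ ≤ T} : ℝ) := by
    exact_mod_cast card_hyperbolic_add_card hT0.le
  set S : ℝ := (Nat.card {γ : SL2Z // frobNorm γ ≤ T ∧ |trZ γ| ≤ 2} : ℝ)
  set G : ℝ := (Nat.card {γ : SL2Z // frobNorm γ ≤ T} : ℝ)
  have hS0 : 0 ≤ S := Nat.cast_nonneg _
  have hG0 : 0 < G := lt_of_lt_of_le (by positivity) hG
  have hpow : T ^ (1 + η) = T ^ 2 * T ^ (-1 + η) := by
    rw [← Real.rpow_natCast, ← Real.rpow_add hT0]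
    congr 1
    push_cast
    ring
  refine ⟨hS.trans ?_, ?_⟩
  · have : 0 ≤ C * T ^ (1 + η) := by positivity
    linarith
  · rw [eq_sub_of_add_eq hadd, sub_div, div_self hG0.ne', sub_sub_cancel_left, abs_neg,
      abs_of_nonneg (by positivity), div_le_iff₀ hG0]
    calc S ≤ C * (T ^ 2 * T ^ (-1 + η)) := hpow ▸ hS
      _ = 64 * C * T ^ (-1 + η) * (T ^ 2 / 64) := by ring
      _ ≤ _ := by gcongr
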